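/- arXiv:1605.02758 — 2 statements merged into one kernel-verified Lean document; each statement's English description precedes it below -/
import Mathlib

section
/- Let P be a locally finite pocset and let ∼ be an admissible equivalence relation on P. Let h, l ∈ P and let [k] be a ∼-class of halfspaces such that [h] < [k] and [k] < [l] in the quotient P/∼. Then some hyperplane belonging to the class [k̂] separates ĥ and l̂. If moreover h < l in P, then there exists a halfspace k' ∈ [k] with h < k' < l. -/
/- Pocsets, hyperplanes, admissible equivalence relations, quotients,
   admissible maps, embeddings, resolutions, group actions on pocsets,
   elementary folds and folding sequences. -/

universe u v w

/-- A pocset: a poset with an order-reversing involution `star` such that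
`h ≠ h *` and `h`, `h *` are incomparable. -/
structure Pocset (P : Type u) where
  le : P → P → Prop
  star : P → P
  le_refl : ∀ a, le a a
  le_trans : ∀ {a b c}, le a b → le b c → le a c
  le_antisymm : ∀ {a b}, le a b → le b a → a = b
  star_star : ∀ a, star (star a) = a
  star_antitone : ∀ {a b}, le a b → le (star b) (star a)
  ne_star : ∀ a, a ≠ star a
  not_le_star : ∀ a, ¬ le a (star a)
  not_star_le : ∀ a, ¬ le (star a) a

namespace Pocset

variable {P : Type u} {P' : Type v}

/-- Strict order. -/
def lt (Q : Pocset P) (a b : P) : Prop := Q.le a b ∧ a ≠ b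

/-- The orientations of the hyperplane `ĥ` determined by the halfspace `h`. -/
def orient (Q : Pocset P) (h : P) : Set P := {h, Q.star h}

/-- `k` is an orientation of the same hyperplane as `h`, i.e. `k̂ = ĥ`. -/
def sameHyp (Q : Pocset P) (h k : P) : Prop := k = h ∨ k = Q.star h

/-- The hyperplanes `ĥ` and `k̂` are transverse: they are distinct and no
orientation of `ĥ` is comparable with any orientation of `k̂`. -/
def transverse (Q : Pocset P) (h k : P) : Prop :=
  ¬ Q.sameHyp h k ∧ ∀ a ∈ Q.orient h, ∀ b ∈ Q.orient k, ¬ Q.le a b ∧ ¬ Q.le b a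

/-- Two hyperplanes are disjoint if they are distinct and not transverse. -/
def disjointHyp (Q : Pocset P) (h k : P) : Prop :=
  ¬ Q.sameHyp h k ∧ ¬ Q.transverse h k

/-- The halfspaces `h` and `k` are facing: `h* < k`. -/
def facing (Q : Pocset P) (h k : P) : Prop := Q.lt (Q.star h) k

/-- The halfspaces `h` and `k` are compatible: not `k ≤ h*`. -/
def compatible (Q : Pocset P) (h k : P) : Prop := ¬ Q.le k (Q.star h)

/-- The hyperplane `k̂` separates the hyperplanes `ĥ` and `l̂`: there are
orientations with `a < b < c`. -/
def separates (Q : Pocset P) (k h l : P) : Prop :=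
  ∃ a ∈ Q.orient h, ∃ b ∈ Q.orient k, ∃ c ∈ Q.orient l, Q.lt a b ∧ Q.lt b c

/-- Local finiteness: every interval is finite. -/
def LocallyFinite (Q : Pocset P) : Prop :=
  ∀ a b : P, {c : P | Q.le a c ∧ Q.le c b}.Finite

/-- The equivalence relation induced on hyperplanes by a relation `r` on
halfspaces: `ĥ ∼ k̂` iff `h ∼ k` or `h ∼ k*`. -/
def hypRel (Q : Pocset P) (r : P → P → Prop) (h k : P) : Prop :=
  r h k ∨ r h (Q.star k)

/-- An admissible equivalence relation on a pocset. -/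
structure IsAdmissible (Q : Pocset P) (r : P → P → Prop) : Prop where
  equiv : Equivalence r
  aer1 : ∀ h, ¬ r h (Q.star h)
  aer2 : ∀ h k, r h k → r (Q.star h) (Q.star k)
  aer3 : ∀ h k, Q.transverse h k → ¬ r h k
  aer4 : ∀ h k, Q.hypRel r h k → ¬ Q.sameHyp h k →
    (∀ m, Q.hypRel r h m → ¬ Q.separates m h k) →
    ∀ a ∈ Q.orient h, ∀ b ∈ Q.orient k, Q.facing a b → r a b

/-- The strict quotient relation: `[h] < [k]` iff `[h] ≠ [k]`, every pair of
representatives has disjoint hyperplanes, and `h' < k'` for every pair of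
representatives whose hyperplanes are `([ĥ] ∪ [k̂])`-inseparable. -/
def QuotLT (Q : Pocset P) (r : P → P → Prop) (h k : P) : Prop :=
  ¬ r h k ∧
  (∀ h' k', r h h' → r k k' → Q.disjointHyp h' k') ∧
  (∀ h' k', r h h' → r k k' →
    (∀ m, (Q.hypRel r h m ∨ Q.hypRel r k m) → ¬ Q.separates m h' k') → Q.lt h' k')

/-- The quotient relation: `[h] ≤ [k]` iff `[h] = [k]` or `[h] < [k]`. -/
def QuotLE (Q : Pocset P) (r : P → P → Prop) (h k : P) : Prop :=
  r h k ∨ Q.QuotLT r h k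

/-- Transversality of `[ĥ]` and `[k̂]` in the quotient pocset. -/
def QuotTransverse (Q : Pocset P) (r : P → P → Prop) (h k : P) : Prop :=
  ¬ Q.hypRel r h k ∧
  ∀ a ∈ Q.orient h, ∀ b ∈ Q.orient k, ¬ Q.QuotLE r a b ∧ ¬ Q.QuotLE r b a

/-- `[k̂]` separates `[ĥ]` and `[l̂]` in the quotient pocset. -/
def QuotSeparates (Q : Pocset P) (r : P → P → Prop) (k h l : P) : Prop :=
  ∃ a ∈ Q.orient h, ∃ b ∈ Q.orient k, ∃ c ∈ Q.orient l,
    Q.QuotLT r a b ∧ Q.QuotLT r b c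

/-- `[h]` and `[k]` are facing in the quotient pocset: `[h]* < [k]`. -/
def QuotFacing (Q : Pocset P) (r : P → P → Prop) (h k : P) : Prop :=
  Q.QuotLT r (Q.star h) k

/-- An admissible map of pocsets. -/
structure IsAdmissibleMap (Q : Pocset P) (Q' : Pocset P') (f : P → P') : Prop where
  am1 : ∀ h, f (Q.star h) = Q'.star (f h)
  am2 : ∀ h k, Q.transverse h k → Q'.transverse (f h) (f k)
  am3 : ∀ h k, Q.facing h k → Q'.sameHyp (f h) (f k) →
    (∀ m, Q'.sameHyp (f m) (f h) → ¬ Q.separates m h k) → f h = f k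
  am4 : ∀ h' : P', (∀ m : P, ¬ Q'.sameHyp (f m) h') →
    ∃ b ∈ Q'.orient h', ∀ m : P, Q'.compatible b (f m)

/-- An embedding of pocsets: an injective, order-reflecting admissible map. -/
structure IsPocsetEmbedding (Q : Pocset P) (Q' : Pocset P') (f : P → P') : Prop where
  adm : IsAdmissibleMap Q Q' f
  inj : Function.Injective f
  le_reflect : ∀ h k, Q'.le (f h) (f k) → Q.le h k

/-- The equivalence relation `∼_f` induced by a map `f`. -/
def simRel (f : P → P') : P → P → Prop := fun a b => f a = f b

/-- A resolution of pocsets: an admissible map `f` such that `∼_f` is an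
admissible equivalence relation and the induced map `P/∼_f → P'` is an
embedding of pocsets (stated here on representatives: `quot_am2` and
`quot_am3` are admissibility of the induced map, `le_reflect` is
order-reflection; injectivity of the induced map is automatic, and its
properties (AM1) and (AM4) coincide with those of `f`). -/
structure IsResolution (Q : Pocset P) (Q' : Pocset P') (f : P → P') : Prop where
  adm : IsAdmissibleMap Q Q' f
  aer : Q.IsAdmissible (simRel f)
  quot_am2 : ∀ h k, Q.QuotTransverse (simRel f) h k → Q'.transverse (f h) (f k)
  quot_am3 : ∀ h k, Q.QuotFacing (simRel f) h k → Q'.sameHyp (f h) (f k) →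
    (∀ m, Q'.sameHyp (f m) (f h) → ¬ Q.QuotSeparates (simRel f) m h k) → f h = f k
  le_reflect : ∀ h k, Q'.le (f h) (f k) → Q.QuotLE (simRel f) h k

/-- A group `G` acts (without inversion) on the pocset `Q` by order-preserving
bijections commuting with `star`. -/
structure IsGAction (Q : Pocset P) (G : Type w) [Group G] [MulAction G P] : Prop where
  smul_le : ∀ (g : G) (a b : P), Q.le a b → Q.le (g • a) (g • b)
  smul_star : ∀ (g : G) (a : P), g • Q.star a = Q.star (g • a)
  no_inversion : ∀ (g : G) (a : P), g • a ≠ Q.star a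

/-- `G`-equivariance of a map. -/
def Equivariant (G : Type w) [Group G] [MulAction G P] [MulAction G P']
    (f : P → P') : Prop :=
  ∀ (g : G) (a : P), f (g • a) = g • f a

/-- An elementary foldable pair for a resolution `f`: facing halfspaces with
`f h₁ = f h₂`, whose hyperplanes are `f⁻¹(f(ĥ₁))`-inseparable, such that no
pair of distinct `∼_f`-equivalent hyperplanes both separate `ĥ₁` and `ĥ₂`. -/
def ElemFoldable (Q : Pocset P) (Q' : Pocset P') (f : P → P') (h₁ h₂ : P) : Prop :=
  Q.facing h₁ h₂ ∧ f h₁ = f h₂ ∧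
  (∀ m, Q'.sameHyp (f m) (f h₁) → ¬ Q.separates m h₁ h₂) ∧
  (∀ m m', Q'.sameHyp (f m) (f m') → ¬ Q.sameHyp m m' →
    ¬ (Q.separates m h₁ h₂ ∧ Q.separates m' h₁ h₂))

/-- `r` is the smallest `G`-invariant and `star`-invariant equivalence
relation with `h₁ ∼ h₂`. -/
structure IsFoldRel (Q : Pocset P) (G : Type w) [Group G] [MulAction G P]
    (h₁ h₂ : P) (r : P → P → Prop) : Prop where
  equiv : Equivalence r
  ginv : ∀ (g : G) (a b : P), r a b → r (g • a) (g • b)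
  sinv : ∀ a b, r a b → r (Q.star a) (Q.star b)
  base : r h₁ h₂
  min : ∀ s : P → P → Prop, Equivalence s →
    (∀ (g : G) (a b : P), s a b → s (g • a) (g • b)) →
    (∀ a b, s a b → s (Q.star a) (Q.star b)) → s h₁ h₂ →
    ∀ a b, r a b → s a b

/-- `[h₁]`, `[h₂]` is an elementary foldable pair in the quotient pocset
`P/r` for the resolution induced by `f` on `P/r`. -/
def QuotElemFoldable (Q : Pocset P) (Q' : Pocset P') (f : P → P')
    (r : P → P → Prop) (h₁ h₂ : P) : Prop :=
  Q.QuotFacing r h₁ h₂ ∧ f h₁ = f h₂ ∧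
  (∀ m, Q'.sameHyp (f m) (f h₁) → ¬ Q.QuotSeparates r m h₁ h₂) ∧
  (∀ m m', Q'.sameHyp (f m) (f m') → ¬ Q.hypRel r m m' →
    ¬ (Q.QuotSeparates r m h₁ h₂ ∧ Q.QuotSeparates r m' h₁ h₂))

/-- `r'` is (the pullback to `P` of) the smallest `G`-invariant and
`star`-invariant equivalence relation on `P/r` identifying `[h₁] ∼ [h₂]`,
i.e. the smallest `G`-invariant, `star`-invariant equivalence relation on `P`
containing `r` with `h₁ ∼ h₂`. -/
structure IsFoldStepRel (Q : Pocset P) (G : Type w) [Group G] [MulAction G P]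
    (r : P → P → Prop) (h₁ h₂ : P) (r' : P → P → Prop) : Prop where
  equiv : Equivalence r'
  mono : ∀ a b, r a b → r' a b
  ginv : ∀ (g : G) (a b : P), r' a b → r' (g • a) (g • b)
  sinv : ∀ a b, r' a b → r' (Q.star a) (Q.star b)
  base : r' h₁ h₂
  min : ∀ s : P → P → Prop, Equivalence s → (∀ a b, r a b → s a b) →
    (∀ (g : G) (a b : P), s a b → s (g • a) (g • b)) →
    (∀ a b, s a b → s (Q.star a) (Q.star b)) → s h₁ h₂ →
    ∀ a b, r' a b → s a b

/-- A finite folding sequence `P = P₀ ↝ P₁ ↝ ⋯ ↝ Pₙ` for a `G`-equivariant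
resolution `f : P → P'`, encoded by the sequence of equivalence relations
`rs i` on `P` with `Pᵢ = P / rs i`: `rs 0` is equality, every `rs i` refines
`∼_f`, and each step is an elementary fold (of an elementary foldable pair
for the induced resolution `fᵢ : P/rs i → P'`). -/
def IsFoldingSequence (Q : Pocset P) (Q' : Pocset P') (G : Type w) [Group G]
    [MulAction G P] (f : P → P') (n : ℕ)
    (rs : Fin (n + 1) → (P → P → Prop)) : Prop :=
  (∀ a b : P, rs 0 a b ↔ a = b) ∧
  (∀ (i : Fin (n + 1)) (a b : P), rs i a b → f a = f b) ∧
  (∀ i : Fin n, ∃ h₁ h₂ : P,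
    Q.QuotElemFoldable Q' f (rs i.castSucc) h₁ h₂ ∧
    Q.IsFoldStepRel G (rs i.castSucc) h₁ h₂ (rs i.succ))

end Pocset

namespace Pocset

variable {P : Type u} {Q : Pocset P} {r : P → P → Prop} {a b c h k l m n : P}

theorem lt_trans (hab : Q.lt a b) (hbc : Q.lt b c) : Q.lt a c :=
  ⟨Q.le_trans hab.1 hbc.1, fun e => hab.2 (Q.le_antisymm hab.1 (e ▸ hbc.1))⟩

theorem lt_of_lt_of_le (hab : Q.lt a b) (hbc : Q.le b c) : Q.lt a c :=
  ⟨Q.le_trans hab.1 hbc, fun e => hab.2 (Q.le_antisymm hab.1 (e ▸ hbc))⟩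

theorem not_lt_self : ¬ Q.lt a a := fun h => h.2 rfl

theorem lt_star (hab : Q.lt a b) : Q.lt (Q.star b) (Q.star a) :=
  ⟨Q.star_antitone hab.1, fun e => hab.2 (by rw [← Q.star_star a, ← e, Q.star_star])⟩

theorem lt_star_comm (hab : Q.lt a (Q.star b)) : Q.lt b (Q.star a) := by
  simpa only [Q.star_star] using lt_star hab

theorem star_lt_comm (hab : Q.lt (Q.star a) b) : Q.lt (Q.star b) a := by
  simpa only [Q.star_star] using lt_star hab

theorem not_lt_lt_star (h₁ : Q.lt a b) (h₂ : Q.lt a (Q.star b)) : False :=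
  Q.not_le_star a (lt_trans h₁ (lt_star_comm h₂)).1

theorem not_lt_star_lt (h₁ : Q.lt a b) (h₂ : Q.lt (Q.star a) b) : False :=
  Q.not_star_le b (lt_trans (star_lt_comm h₂) h₁).1

theorem separates_of_lt (h₁ : Q.lt a b) (h₂ : Q.lt b c) : Q.separates b a c :=
  ⟨a, Or.inl rfl, b, Or.inl rfl, c, Or.inl rfl, h₁, h₂⟩

theorem mem_orient_star : a ∈ Q.orient (Q.star b) ↔ a ∈ Q.orient b := by
  simp only [orient, Set.mem_insert_iff, Set.mem_singleton_iff, Q.star_star]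
  exact or_comm

theorem star_mem_orient (ha : a ∈ Q.orient b) : Q.star a ∈ Q.orient b := by
  rcases ha with rfl | rfl
  · exact Or.inr rfl
  · exact Or.inl (Q.star_star b)

theorem separates_comm (hs : Q.separates k h l) : Q.separates k l h := by
  obtain ⟨a, ha, b, hb, c, hc, hab, hbc⟩ := hs
  exact ⟨_, star_mem_orient hc, _, star_mem_orient hb, _, star_mem_orient ha,
    lt_star hbc, lt_star hab⟩

theorem separates_star_left : Q.separates k (Q.star h) l ↔ Q.separates k h l := by
  simp only [separates, mem_orient_star]

theorem separates_star_right : Q.separates k h (Q.star l) ↔ Q.separates k h l := by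
  simp only [separates, mem_orient_star]

/-- Nested halfspaces are separated only by hyperplanes with an orientation between them. -/
theorem exists_between_of_separates (ham : Q.lt a m) (hs : Q.separates n a m) :
    ∃ b ∈ Q.orient n, Q.lt a b ∧ Q.lt b m := by
  obtain ⟨x, hx, b, hb, y, hy, hxb, hby⟩ := hs
  have hxy := lt_trans hxb hby
  rcases hx with rfl | rfl <;> rcases hy with rfl | rfl
  · exact ⟨b, hb, hxb, hby⟩
  · exact (not_lt_lt_star ham hxy).elim
  · exact (not_lt_star_lt ham hxy).elim
  · exact (not_lt_self (lt_trans (lt_star ham) hxy)).elim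

/-- `â` lies inside the halfspace `b`. -/
def inside (Q : Pocset P) (a b : P) : Prop := ∃ x ∈ Q.orient a, Q.lt x b

theorem not_inside_star (h₁ : Q.inside a b) (h₂ : Q.inside a (Q.star b)) : False := by
  obtain ⟨x, hx, hxb⟩ := h₁
  obtain ⟨y, hy, hyb⟩ := h₂
  rcases hx with rfl | rfl <;> rcases hy with rfl | rfl
  · exact not_lt_lt_star hxb hyb
  · exact not_lt_self (lt_trans hxb (by simpa only [Q.star_star] using lt_star hyb))
  · exact not_lt_self (lt_trans hyb (star_lt_comm hxb))
  · exact not_lt_lt_star hxb hyb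

theorem separates_of_inside (h₁ : Q.inside a b) (h₂ : Q.inside c (Q.star b)) :
    Q.separates b a c := by
  obtain ⟨x, hx, hxb⟩ := h₁
  obtain ⟨y, hy, hyb⟩ := h₂
  exact ⟨x, hx, b, Or.inl rfl, _, star_mem_orient hy, hxb, lt_star_comm hyb⟩

theorem disjointHyp.inside_or (hd : Q.disjointHyp a b) :
    Q.inside a b ∨ Q.inside a (Q.star b) := by
  obtain ⟨hne, ht⟩ := hd
  have key : ∀ x ∈ Q.orient a, ∀ y ∈ Q.orient b, x ≠ y := by
    intro x hx y hy e
    apply hne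
    rcases hx with hx | hx <;> rcases hy with hy | hy <;> rw [hx, hy] at e
    · exact Or.inl e.symm
    · exact Or.inr (by rw [e, Q.star_star])
    · exact Or.inr e.symm
    · exact Or.inl (by rw [← Q.star_star b, ← e, Q.star_star])
  have hlt : ∃ x ∈ Q.orient a, ∃ y ∈ Q.orient b, Q.lt x y := by
    by_contra hcon
    push Not at hcon
    refine ht ⟨hne, fun x hx y hy => ⟨fun hle => hcon x hx y hy ⟨hle, key x hx y hy⟩,
      fun hle => ?_⟩⟩
    exact hcon _ (star_mem_orient hx) _ (star_mem_orient hy)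
      (lt_star ⟨hle, (key x hx y hy).symm⟩)
  obtain ⟨x, hx, y, rfl | rfl, hxy⟩ := hlt
  · exact Or.inl ⟨x, hx, hxy⟩
  · exact Or.inr ⟨x, hx, hxy⟩

theorem LocallyFinite.exists_minimal_above (hLF : Q.LocallyFinite) {p : P → Prop}
    (hab : Q.lt a b) (hb : p b) :
    ∃ m, p m ∧ Q.lt a m ∧ Q.le m b ∧ ∀ n, p n → Q.lt a n → ¬ Q.lt n m := by
  let _ : PartialOrder P :=
    { le := Q.le
      le_refl := Q.le_refl
      le_trans := fun _ _ _ => Q.le_trans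
      le_antisymm := fun _ _ => Q.le_antisymm }
  have hfin : {c : P | p c ∧ Q.lt a c ∧ Q.le c b}.Finite :=
    (hLF a b).subset fun c hc => ⟨hc.2.1.1, hc.2.2⟩
  obtain ⟨m, ⟨hpm, ham, hmb⟩, hmin⟩ := hfin.exists_minimal ⟨b, hb, hab, Q.le_refl b⟩
  exact ⟨m, hpm, ham, hmb, fun n hpn han hnm =>
    hnm.2 (Q.le_antisymm hnm.1 (hmin ⟨hpn, han, Q.le_trans hnm.1 hmb⟩ hnm.1))⟩

theorem hypRel_star (hs : Q.hypRel r k m) : Q.hypRel r k (Q.star m) := by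
  rw [hypRel, Q.star_star]
  exact hs.symm

theorem hypRel_of_mem_orient (hs : Q.hypRel r k m) (hb : b ∈ Q.orient m) : Q.hypRel r k b := by
  rcases hb with rfl | rfl
  · exact hs
  · exact hypRel_star hs

/-- Below any halfspace of a hyperplane class that contains `a` there is one whose
hyperplane is not separated from `â` by the class. -/
theorem LocallyFinite.exists_inseparable_above (hLF : Q.LocallyFinite)
    (hab : Q.lt a b) (hb : Q.hypRel r k b) :
    ∃ m, Q.hypRel r k m ∧ Q.lt a m ∧ Q.le m b ∧
      ∀ n, Q.hypRel r k n → ¬ Q.separates n a m := by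
  obtain ⟨m, hpm, ham, hmb, hmin⟩ := hLF.exists_minimal_above hab hb
  refine ⟨m, hpm, ham, hmb, fun n hn hs => ?_⟩
  obtain ⟨c, hc, hac, hcm⟩ := exists_between_of_separates ham hs
  exact hmin c (hypRel_of_mem_orient hn hc) hac hcm

/-- If `[h] < [k]` then `ĥ` lies inside every representative of `[k]` from which it is not
separated by `[k̂]`. -/
theorem QuotLT.inside (hLF : Q.LocallyFinite) (hhk : Q.QuotLT r h k)
    (hrefl : ∀ x, r x x) (hk : r k m)
    (hsep : ∀ n, Q.hypRel r k n → ¬ Q.separates n m h) : Q.inside h m := by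
  refine (hhk.2.1 h m (hrefl h) hk).inside_or.resolve_right ?_
  rintro ⟨x, hx, hxm⟩
  have hmx := lt_star_comm hxm
  have hhx : Q.hypRel r h (Q.star x) :=
    hypRel_star (hypRel_of_mem_orient (Or.inl (hrefl h)) hx)
  obtain ⟨c, hc, hmc, hcx, hcsep⟩ := hLF.exists_inseparable_above hmx hhx
  have hksep : ∀ n, Q.hypRel r k n → ¬ Q.separates n m c := by
    intro n hn hs
    obtain ⟨b, hb, hmb, hbc⟩ := exists_between_of_separates hmc hs
    exact hsep b (hypRel_of_mem_orient hn hb)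
      ⟨m, Or.inl rfl, b, Or.inl rfl, _, star_mem_orient hx, hmb, lt_of_lt_of_le hbc hcx⟩
  have hboth : ∀ n, Q.hypRel r h n ∨ Q.hypRel r k n → ¬ Q.separates n c m :=
    fun n hn hs => hn.elim (fun hn => hcsep n hn (separates_comm hs))
      fun hn => hksep n hn (separates_comm hs)
  rcases hc with hc | hc
  · exact not_lt_self (lt_trans hmc (hhk.2.2 c m hc hk hboth))
  · exact not_lt_star_lt hmc (star_lt_comm (hhk.2.2 _ m hc hk
      fun n hn hs => hboth n hn (separates_star_left.1 hs)))

theorem sameHyp_comm : Q.sameHyp a b ↔ Q.sameHyp b a := by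
  have key : ∀ {x y}, Q.sameHyp x y → Q.sameHyp y x := by
    rintro x y (rfl | rfl)
    · exact Or.inl rfl
    · exact Or.inr (Q.star_star x).symm
  exact ⟨key, key⟩

theorem disjointHyp_comm : Q.disjointHyp a b ↔ Q.disjointHyp b a := by
  have key : ∀ {x y}, Q.transverse x y → Q.transverse y x := fun ht =>
    ⟨fun hs => ht.1 (sameHyp_comm.1 hs), fun x hx y hy => (ht.2 y hy x hx).symm⟩
  exact and_congr (not_congr sameHyp_comm) (not_congr ⟨key, key⟩)

theorem disjointHyp_star_right : Q.disjointHyp a (Q.star b) ↔ Q.disjointHyp a b := by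
  have hs : Q.sameHyp a (Q.star b) ↔ Q.sameHyp a b := by
    rw [sameHyp_comm, sameHyp_comm (a := a)]
    simp only [sameHyp, Q.star_star]
    exact or_comm
  simp only [disjointHyp, transverse, mem_orient_star, hs]

theorem disjointHyp_star_left : Q.disjointHyp (Q.star a) b ↔ Q.disjointHyp a b := by
  rw [disjointHyp_comm, disjointHyp_star_right, disjointHyp_comm]

theorem IsAdmissible.rel_star (hr : Q.IsAdmissible r) (hab : r (Q.star a) b) :
    r a (Q.star b) := by
  simpa only [Q.star_star] using hr.aer2 _ _ hab

theorem IsAdmissible.hypRel_star_left (hr : Q.IsAdmissible r) (hab : Q.hypRel r a b) :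
    Q.hypRel r (Q.star a) b :=
  hab.elim (fun hab => Or.inr (hr.aer2 _ _ hab)) fun hab =>
    Or.inl (by simpa only [Q.star_star] using hr.aer2 _ _ hab)

theorem QuotLT.star (hr : Q.IsAdmissible r) (hkl : Q.QuotLT r k l) :
    Q.QuotLT r (Q.star l) (Q.star k) := by
  refine ⟨fun e => hkl.1 (hr.equiv.symm ?_), fun l' k' hl hk => ?_, fun l' k' hl hk hs => ?_⟩
  · simpa only [Q.star_star] using hr.aer2 _ _ e
  · rw [← disjointHyp_star_left, ← disjointHyp_star_right, disjointHyp_comm]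
    exact hkl.2.1 _ _ (hr.rel_star hk) (hr.rel_star hl)
  · have := hkl.2.2 _ _ (hr.rel_star hk) (hr.rel_star hl) fun m hm hsm =>
      hs m (hm.symm.imp hr.hypRel_star_left hr.hypRel_star_left)
        (separates_comm (separates_star_left.1 (separates_star_right.1 hsm)))
    simpa only [Q.star_star] using lt_star this

theorem exists_mem_orient_rel (hm : Q.hypRel r k m) : ∃ b ∈ Q.orient m, r k b :=
  hm.elim (fun h => ⟨m, Or.inl rfl, h⟩) fun h => ⟨_, Or.inr rfl, h⟩

theorem separates_orient_left (hx : a ∈ Q.orient h) :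
    Q.separates k a l ↔ Q.separates k h l := by
  rcases hx with rfl | rfl
  · rfl
  · exact separates_star_left

theorem separates_orient_right (hx : a ∈ Q.orient l) :
    Q.separates k h a ↔ Q.separates k h l := by
  rcases hx with rfl | rfl
  · rfl
  · exact separates_star_right

theorem QuotLT.inside_or (hhk : Q.QuotLT r h k) (hh : r h h) (hm : Q.hypRel r k m) :
    Q.inside h m ∨ Q.inside h (Q.star m) :=
  hm.elim (fun hm => (hhk.2.1 _ _ hh hm).inside_or)
    fun hm => (disjointHyp_star_right.1 (hhk.2.1 _ _ hh hm)).inside_or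

theorem inside_star_left : Q.inside (Q.star a) b ↔ Q.inside a b := by
  simp only [inside, mem_orient_star]

theorem exists_separates_of_quotLT (hLF : Q.LocallyFinite) (hr : Q.IsAdmissible r)
    (hhk : Q.QuotLT r h k) (hkl : Q.QuotLT r k l) :
    ∃ m, Q.hypRel r k m ∧ Q.separates m h l := by
  by_contra hno
  push Not at hno
  have hrefl := hr.equiv.refl
  obtain ⟨b, hb, x, hx, hxb⟩ : ∃ b, Q.hypRel r k b ∧ Q.inside h b :=
    (hhk.inside_or (hrefl h) (Or.inl (hrefl k))).elim (fun hi => ⟨k, Or.inl (hrefl k), hi⟩)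
      fun hi => ⟨_, hypRel_star (Or.inl (hrefl k)), hi⟩
  obtain ⟨m, hm, -, -, hsep⟩ := hLF.exists_inseparable_above hxb hb
  obtain ⟨c, hc, hkc⟩ := exists_mem_orient_rel hm
  have hcsep : ∀ n, Q.hypRel r k n → ¬ Q.separates n h c := fun n hn hs =>
    hsep n hn ((separates_orient_left hx).2 ((separates_orient_right hc).1 hs))
  have hin := hhk.inside hLF hrefl hkc fun n hn hs => hcsep n hn (separates_comm hs)
  have hkl' := hkl.star hr
  have hlsep : ∀ n, Q.hypRel r k n → ¬ Q.separates n c l := by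
    intro n hn hs
    rcases hkl'.inside_or (hrefl _) (hr.hypRel_star_left (Or.inl hkc)) with hi | hi <;>
      rw [inside_star_left] at hi
    · obtain ⟨z, hz, hzc⟩ := hi
      obtain ⟨d, hd, hzd, hdc⟩ := exists_between_of_separates hzc
        (separates_comm ((separates_orient_right hz).2 hs))
      have hkd := hypRel_of_mem_orient hn hd
      rcases hhk.inside_or (hrefl h) hkd with ⟨w, hw, hwd⟩ | hi
      · exact hcsep d hkd ((separates_orient_left hw).1 (separates_of_lt hwd hdc))
      · exact hno d hkd (separates_comm (separates_of_inside ⟨z, hz, hzd⟩ hi))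
    · exact hno c (Or.inl hkc) (separates_of_inside hin hi)
  have hin' := hkl'.inside hLF hrefl (hr.aer2 _ _ hkc) fun n hn hs =>
    hlsep n (by simpa only [Q.star_star] using hr.hypRel_star_left hn)
      (separates_star_left.1 (separates_star_right.1 hs))
  exact hno c (Or.inl hkc) (separates_of_inside hin (inside_star_left.1 hin'))

theorem exists_between_of_quotLT (hLF : Q.LocallyFinite) (hr : Q.IsAdmissible r)
    (hhk : Q.QuotLT r h k) (hkl : Q.QuotLT r k l) (hhl : Q.lt h l) :
    ∃ m, r k m ∧ Q.lt h m ∧ Q.lt m l := by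
  obtain ⟨n, hn, hs⟩ := exists_separates_of_quotLT hLF hr hhk hkl
  obtain ⟨b, hb, hhb, hbl⟩ := exists_between_of_separates hhl hs
  obtain ⟨m, hm, hhm, hmb, hsep⟩ :=
    hLF.exists_inseparable_above hhb (hypRel_of_mem_orient hn hb)
  refine ⟨m, hm.resolve_right fun hkm => ?_, hhm, Q.le_trans hmb hbl.1,
    fun e => hbl.2 (Q.le_antisymm hbl.1 (e ▸ hmb))⟩
  exact not_inside_star ⟨h, Or.inl rfl, hhm⟩ (hhk.inside hLF hr.equiv.refl hkm
    fun n hn hs => hsep n hn (separates_comm (separates_star_left.1 hs)))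

end Pocset

/-- if `[h] < [k]` and `[k] < [l]` then some hyperplane of the
class `[k̂]` separates `ĥ` and `l̂`; if moreover `h < l`, there is
`k' ∈ [k]` with `h < k' < l`. -/
theorem separating_representative_of_middle_class {P : Type u} (Q : Pocset P)
    (hLF : Q.LocallyFinite) (r : P → P → Prop) (hr : Q.IsAdmissible r)
    (h l k : P) (hhk : Q.QuotLT r h k) (hkl : Q.QuotLT r k l) :
    (∃ k' : P, Q.hypRel r k k' ∧ Q.separates k' h l) ∧
    (Q.lt h l → ∃ k' : P, r k k' ∧ Q.lt h k' ∧ Q.lt k' l) :=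
  ⟨Pocset.exists_separates_of_quotLT hLF hr hhk hkl,
    Pocset.exists_between_of_quotLT hLF hr hhk hkl⟩
end

section
/- Let P be a locally finite pocset and let ∼ be an admissible equivalence relation on P. Then the quotient map P → P/∼, h ↦ [h], is a resolution of pocsets. -/
/- Pocsets, hyperplanes, admissible equivalence relations, quotients,
   admissible maps, embeddings, resolutions, group actions on pocsets,
   elementary folds and folding sequences. -/

universe u v w

namespace Pocset

section Basic

variable {P : Type u} (Q : Pocset P)

theorem orient_symm {x y : P} (h : x ∈ Q.orient y) : y ∈ Q.orient x := by
  rcases h with rfl | rfl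
  · exact Or.inl rfl
  · exact Or.inr (Q.star_star _).symm

theorem star_mem_orient_s5 {x y : P} (h : x ∈ Q.orient y) : Q.star x ∈ Q.orient y := by
  rcases h with rfl | rfl
  · exact Or.inr rfl
  · exact Or.inl (Q.star_star _)

theorem orient_trans {x y z : P} (h : x ∈ Q.orient y) (h' : y ∈ Q.orient z) :
    x ∈ Q.orient z := by
  rcases h with rfl | rfl
  · exact h'
  · exact Q.star_mem_orient_s5 h'

theorem self_mem_orient (x : P) : x ∈ Q.orient x := Or.inl rfl

theorem lt_of_le_of_lt {x y z : P} (h : Q.le x y) (h' : Q.lt y z) : Q.lt x z :=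
  ⟨Q.le_trans h h'.1, by rintro rfl; exact h'.2 (Q.le_antisymm h'.1 h)⟩

theorem lt_trans_s5 {x y z : P} (h : Q.lt x y) (h' : Q.lt y z) : Q.lt x z :=
  Q.lt_of_le_of_lt h.1 h'

theorem star_lt {x y : P} (h : Q.lt x y) : Q.lt (Q.star y) (Q.star x) :=
  ⟨Q.star_antitone h.1, fun e => h.2 (by rw [← Q.star_star x, ← e, Q.star_star])⟩

theorem lt_star_s5 {x y : P} (h : Q.lt x (Q.star y)) : Q.lt y (Q.star x) := by
  simpa only [Q.star_star] using Q.star_lt h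

/-- Two disjoint hyperplanes have a unique pair of orientations `x < y` up to duality. -/
theorem orient_unique {x y x' y' : P} (h : Q.lt x y) (hx : x' ∈ Q.orient x)
    (hy : y' ∈ Q.orient y) (h' : Q.lt x' y') : x' = x ∧ y' = y := by
  rcases hx with rfl | rfl <;> rcases hy with rfl | rfl
  · exact ⟨rfl, rfl⟩
  · exact absurd (Q.lt_trans_s5 h (Q.lt_star_s5 h')).1 (Q.not_le_star _)
  · exact absurd (Q.lt_trans_s5 (Q.star_lt h) h').1 (Q.not_star_le _)
  · have h'' : Q.lt y x := by simpa only [Q.star_star] using Q.star_lt h'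
    exact absurd rfl (Q.lt_trans_s5 h h'').2

theorem not_sameHyp_of_lt {x y h k : P} (hx : x ∈ Q.orient h) (hy : y ∈ Q.orient k)
    (hxy : Q.lt x y) : ¬ Q.sameHyp h k := by
  intro hs
  rcases Q.orient_trans (Q.orient_trans hy hs) (Q.orient_symm hx) with e | e
  · exact hxy.2 e.symm
  · exact Q.not_le_star x (e ▸ hxy.1)

theorem disjointHyp_of_lt {x y h k : P} (hx : x ∈ Q.orient h) (hy : y ∈ Q.orient k)
    (hxy : Q.lt x y) : Q.disjointHyp h k :=
  ⟨Q.not_sameHyp_of_lt hx hy hxy, fun ht => (ht.2 x hx y hy).1 hxy.1⟩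

theorem exists_lt_of_disjointHyp {h k : P} (hd : Q.disjointHyp h k) :
    ∃ x ∈ Q.orient h, ∃ y ∈ Q.orient k, Q.lt x y := by
  obtain ⟨hs, ht⟩ := hd
  have key : ∃ x ∈ Q.orient h, ∃ y ∈ Q.orient k, Q.le x y := by
    by_contra! hc
    refine ht ⟨hs, fun x hx y hy => ⟨hc x hx y hy, fun hyx => ?_⟩⟩
    exact hc _ (Q.star_mem_orient_s5 hx) _ (Q.star_mem_orient_s5 hy) (Q.star_antitone hyx)
  obtain ⟨x, hx, y, hy, hxy⟩ := key
  refine ⟨x, hx, y, hy, hxy, ?_⟩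
  rintro rfl
  exact hs (Q.orient_trans (Q.orient_symm hy) hx)

theorem disjointHyp_of_orient {h k h' k' : P} (hd : Q.disjointHyp h k) (hh : h ∈ Q.orient h')
    (hk : k ∈ Q.orient k') : Q.disjointHyp h' k' := by
  obtain ⟨x, hx, y, hy, hxy⟩ := Q.exists_lt_of_disjointHyp hd
  exact Q.disjointHyp_of_lt (Q.orient_trans hx hh) (Q.orient_trans hy hk) hxy

theorem disjointHyp_symm {h k : P} (hd : Q.disjointHyp h k) : Q.disjointHyp k h := by
  obtain ⟨x, hx, y, hy, hxy⟩ := Q.exists_lt_of_disjointHyp hd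
  exact Q.disjointHyp_of_lt (Q.star_mem_orient_s5 hy) (Q.star_mem_orient_s5 hx) (Q.star_lt hxy)

theorem separates_of_orient {m h k h' k' : P} (hs : Q.separates m h k) (hh : h ∈ Q.orient h')
    (hk : k ∈ Q.orient k') : Q.separates m h' k' := by
  obtain ⟨x, hx, y, hy, z, hz, hxy, hyz⟩ := hs
  exact ⟨x, Q.orient_trans hx hh, y, hy, z, Q.orient_trans hz hk, hxy, hyz⟩

theorem separates_symm {m h k : P} (hs : Q.separates m h k) : Q.separates m k h := by
  obtain ⟨x, hx, y, hy, z, hz, hxy, hyz⟩ := hs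
  exact ⟨_, Q.star_mem_orient_s5 hz, _, Q.star_mem_orient_s5 hy, _, Q.star_mem_orient_s5 hx,
    Q.star_lt hyz, Q.star_lt hxy⟩

theorem exists_between_of_separates_s5 {m h k x y : P} (hs : Q.separates m h k)
    (hx : x ∈ Q.orient h) (hy : y ∈ Q.orient k) (hxy : Q.lt x y) :
    ∃ n ∈ Q.orient m, Q.lt x n ∧ Q.lt n y := by
  obtain ⟨x', hx', n, hn, y', hy', h₁, h₂⟩ := hs
  obtain ⟨rfl, rfl⟩ := Q.orient_unique hxy (Q.orient_trans hx' (Q.orient_symm hx))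
    (Q.orient_trans hy' (Q.orient_symm hy)) (Q.lt_trans_s5 h₁ h₂)
  exact ⟨n, hn, h₁, h₂⟩

/-- A hyperplane separating `x` and `y` separates one of them from any hyperplane `z`
disjoint from it. -/
theorem separates_or_separates {m x y z : P} (hs : Q.separates m x y)
    (hd : Q.disjointHyp z m) : Q.separates m x z ∨ Q.separates m z y := by
  obtain ⟨x', hx, n, hn, y', hy, h₁, h₂⟩ := hs
  obtain ⟨z', hz, n', hn', h₃⟩ := Q.exists_lt_of_disjointHyp hd
  rcases Q.orient_trans hn' (Q.orient_symm hn) with rfl | rfl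
  · exact Or.inr ⟨z', hz, _, hn, y', hy, h₃, h₂⟩
  · exact Or.inl ⟨x', hx, n, hn, _, Q.star_mem_orient_s5 hz, h₁, Q.lt_star_s5 h₃⟩

end Basic

section LocallyFinite

variable {P : Type u} {Q : Pocset P}

theorem LocallyFinite.exists_maximal (hLF : Q.LocallyFinite) (S : P → Prop) {x y : P}
    (hx : S x) (hxy : Q.lt x y) :
    ∃ m, S m ∧ Q.le x m ∧ Q.lt m y ∧ ∀ n, S n → Q.lt m n → ¬ Q.lt n y := by
  let _ : PartialOrder P :=
    { le := Q.le
      le_refl := Q.le_refl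
      le_trans := fun _ _ _ => Q.le_trans
      le_antisymm := fun _ _ => Q.le_antisymm }
  have hfin : {c : P | S c ∧ Q.le x c ∧ Q.lt c y}.Finite :=
    (hLF x y).subset fun c hc => ⟨hc.2.1, hc.2.2.1⟩
  obtain ⟨m, hm⟩ := hfin.exists_maximal ⟨x, hx, Q.le_refl x, hxy⟩
  refine ⟨m, hm.1.1, hm.1.2.1, hm.1.2.2, fun n hn hmn hny => hmn.2 ?_⟩
  exact Q.le_antisymm hmn.1 (hm.2 ⟨hn, Q.le_trans hm.1.2.1 hmn.1, hny⟩ hmn.1)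

theorem LocallyFinite.exists_minimal (hLF : Q.LocallyFinite) (S : P → Prop) {x y : P}
    (hy : S y) (hxy : Q.lt x y) :
    ∃ m, S m ∧ Q.le m y ∧ Q.lt x m ∧ ∀ n, S n → Q.lt n m → ¬ Q.lt x n := by
  obtain ⟨m, hm, hym, hmx, hmax⟩ := hLF.exists_maximal (fun z => S (Q.star z))
    (x := Q.star y) (y := Q.star x) (by simpa only [Q.star_star] using hy) (Q.star_lt hxy)
  refine ⟨Q.star m, hm, ?_, Q.lt_star_s5 hmx, fun n hn hnm hxn => ?_⟩
  · simpa only [Q.star_star] using Q.star_antitone hym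
  · exact hmax (Q.star n) (by simpa only [Q.star_star] using hn) (Q.lt_star_s5 hnm) (Q.star_lt hxn)

end LocallyFinite

namespace IsAdmissible

variable {P : Type u} {Q : Pocset P} {r : P → P → Prop}

theorem star_iff (hr : Q.IsAdmissible r) {h k : P} : r (Q.star h) k ↔ r h (Q.star k) := by
  constructor <;> intro hk <;> simpa only [Q.star_star] using hr.aer2 _ _ hk

theorem hypRel_iff {h m : P} : Q.hypRel r h m ↔ ∃ n ∈ Q.orient m, r h n := by
  constructor
  · rintro (h₁ | h₁)
    · exact ⟨m, Or.inl rfl, h₁⟩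
    · exact ⟨_, Or.inr rfl, h₁⟩
  · rintro ⟨n, rfl | rfl, hn⟩
    · exact Or.inl hn
    · exact Or.inr hn

theorem hypRel_of_orient {h m n : P} (hm : Q.hypRel r h m) (hn : n ∈ Q.orient m) :
    Q.hypRel r h n := by
  obtain ⟨l, hl, hrl⟩ := hypRel_iff.1 hm
  exact hypRel_iff.2 ⟨l, Q.orient_trans hl (Q.orient_symm hn), hrl⟩

theorem hypRel_star (hr : Q.IsAdmissible r) {h m : P} (hm : Q.hypRel r h m) :
    Q.hypRel r (Q.star h) m := by
  rcases hm with h₁ | h₁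
  · exact Or.inr (hr.aer2 _ _ h₁)
  · exact Or.inl (hr.star_iff.2 h₁)

theorem hypRel_star_iff (hr : Q.IsAdmissible r) {h m : P} :
    Q.hypRel r (Q.star h) m ↔ Q.hypRel r h m :=
  ⟨fun hm => by simpa only [Q.star_star] using hr.hypRel_star hm, hr.hypRel_star⟩

theorem hypRel_symm (hr : Q.IsAdmissible r) {h k : P} (hk : Q.hypRel r h k) :
    Q.hypRel r k h :=
  hk.imp hr.equiv.symm fun h₁ => hr.equiv.symm (hr.star_iff.2 h₁)

theorem hypRel_congr (hr : Q.IsAdmissible r) {h h' m : P} (hh : r h h')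
    (hm : Q.hypRel r h' m) : Q.hypRel r h m :=
  hm.imp (hr.equiv.trans hh) (hr.equiv.trans hh)

theorem quotLT_congr (hr : Q.IsAdmissible r) {a b a' b' : P} (ha : r a a') (hb : r b b')
    (hab : Q.QuotLT r a b) : Q.QuotLT r a' b' := by
  have e := hr.equiv
  refine ⟨fun hc => hab.1 (e.trans ha (e.trans hc (e.symm hb))),
    fun h k hh hk => hab.2.1 h k (e.trans ha hh) (e.trans hb hk),
    fun h k hh hk hm => hab.2.2 h k (e.trans ha hh) (e.trans hb hk) fun m hm' => hm m ?_⟩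
  exact hm'.imp (hr.hypRel_congr (e.symm ha)) (hr.hypRel_congr (e.symm hb))

theorem quotLT_star (hr : Q.IsAdmissible r) {a b : P} (hab : Q.QuotLT r a b) :
    Q.QuotLT r (Q.star b) (Q.star a) := by
  refine ⟨fun hc => ?_, fun k h hk hh => ?_, fun k h hk hh hm => ?_⟩
  · have := hr.aer2 _ _ hc
    rw [Q.star_star, Q.star_star] at this
    exact hab.1 (hr.equiv.symm this)
  · exact Q.disjointHyp_symm (Q.disjointHyp_of_orient
      (hab.2.1 _ _ (hr.star_iff.1 hh) (hr.star_iff.1 hk)) (Or.inr rfl) (Or.inr rfl))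
  · have := hab.2.2 _ _ (hr.star_iff.1 hh) (hr.star_iff.1 hk) fun m hm' hs => hm m
      (hm'.symm.imp hr.hypRel_star hr.hypRel_star)
      (Q.separates_symm (Q.separates_of_orient hs (Or.inr rfl) (Or.inr rfl)))
    simpa only [Q.star_star] using Q.star_lt this

theorem exists_orient_lt (hLF : Q.LocallyFinite) {a b a' b' : P}
    (hab : Q.QuotLT r a b) (ha : r a a') (hb : r b b')
    (hin : ∀ m, Q.hypRel r b m → ¬ Q.separates m a' b') : ∃ x ∈ Q.orient a', Q.lt x b' := by
  obtain ⟨x, hx, y, hy, hxy⟩ := Q.exists_lt_of_disjointHyp (hab.2.1 _ _ ha hb)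
  obtain ⟨s, hs, hxs, hsy, hmax⟩ := hLF.exists_maximal (Q.hypRel r a)
    (hypRel_of_orient (Or.inl ha) hx) hxy
  obtain ⟨t, ht, hat⟩ := hypRel_iff.1 hs
  have hlt : Q.lt t b' := hab.2.2 t b' hat hb fun m hm hsep => by
    obtain ⟨n, hn, h₁, h₂⟩ := Q.exists_between_of_separates_s5 hsep (Q.orient_symm ht) hy hsy
    rcases hm with hm | hm
    · exact hmax n (hypRel_of_orient hm hn) h₁ h₂
    · exact hin m hm ⟨x, hx, n, hn, y, hy, Q.lt_of_le_of_lt hxs h₁, h₂⟩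
  obtain ⟨-, rfl⟩ := Q.orient_unique hsy ht (Q.orient_symm hy) hlt
  exact ⟨x, hx, hxy⟩

theorem exists_lt_orient (hr : Q.IsAdmissible r) (hLF : Q.LocallyFinite) {b c b' c' : P}
    (hbc : Q.QuotLT r b c) (hb : r b b') (hc : r c c')
    (hin : ∀ m, Q.hypRel r b m → ¬ Q.separates m b' c') : ∃ z ∈ Q.orient c', Q.lt b' z := by
  obtain ⟨x, hx, hlt⟩ := exists_orient_lt hLF (hr.quotLT_star hbc) (hr.aer2 _ _ hc)
    (hr.aer2 _ _ hb) fun m hm hs => hin m (hr.hypRel_star_iff.1 hm)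
      (Q.separates_symm (Q.separates_of_orient hs (Or.inr rfl) (Or.inr rfl)))
  exact ⟨_, Q.star_mem_orient_s5 (Q.orient_trans hx (Or.inr rfl)), Q.lt_star_s5 hlt⟩

/-- If `[a] < [b] < [c]`, then any representatives of `[a]` and `[c]` are separated by
a hyperplane in the class of `b`. -/
theorem exists_separates (hr : Q.IsAdmissible r) (hLF : Q.LocallyFinite) {a b c a' c' : P}
    (hab : Q.QuotLT r a b) (hbc : Q.QuotLT r b c) (ha : r a a') (hc : r c c') :
    ∃ m, Q.hypRel r b m ∧ Q.separates m a' c' := by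
  obtain ⟨x, hx, y, hy, hxy⟩ :=
    Q.exists_lt_of_disjointHyp (hab.2.1 _ _ ha (hr.equiv.refl b))
  obtain ⟨s, hs, -, hxs, hmin⟩ := hLF.exists_minimal (Q.hypRel r b)
    (hypRel_of_orient (Or.inl (hr.equiv.refl b)) hy) hxy
  obtain ⟨t, ht, hbt⟩ := hypRel_iff.1 hs
  have hat : ∀ m, Q.hypRel r b m → ¬ Q.separates m a' t := fun m hm hsep => by
    obtain ⟨n, hn, h₁, h₂⟩ := Q.exists_between_of_separates_s5 hsep hx (Q.orient_symm ht) hxs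
    exact hmin n (hypRel_of_orient hm hn) h₂ h₁
  by_cases htc : ∀ m, Q.hypRel r b m → ¬ Q.separates m t c'
  · obtain ⟨u, hu, hut⟩ := exists_orient_lt hLF hab ha hbt hat
    obtain ⟨v, hv, htv⟩ := hr.exists_lt_orient hLF hbc hbt hc htc
    exact ⟨t, Or.inl hbt, u, hu, t, Q.self_mem_orient t, v, hv, hut, htv⟩
  · push Not at htc
    obtain ⟨m, hm, hsep⟩ := htc
    obtain ⟨n, hn, hbn⟩ := hypRel_iff.1 hm
    have hd := Q.disjointHyp_of_orient (hab.2.1 _ _ ha hbn) (Q.self_mem_orient a') hn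
    rcases Q.separates_or_separates hsep hd with h₁ | h₁
    · exact absurd (Q.separates_symm h₁) (hat m hm)
    · exact ⟨m, hm, h₁⟩

theorem left_eq_of_between (hLF : Q.LocallyFinite) {a b a' c' x y z : P}
    (hab : Q.QuotLT r a b) (ha : r a a') (hx : x ∈ Q.orient a') (hy : Q.hypRel r b y)
    (hz : z ∈ Q.orient c') (hxy : Q.lt x y) (hyz : Q.lt y z)
    (hin : ∀ m, Q.hypRel r a m → ¬ Q.separates m a' c') : a' = x := by
  obtain ⟨s, hs, hsy, hxs, hmin⟩ := hLF.exists_minimal (Q.hypRel r b) hy hxy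
  obtain ⟨t, ht, hbt⟩ := hypRel_iff.1 hs
  have hlt : Q.lt a' t := hab.2.2 a' t ha hbt fun m hm hsep => by
    obtain ⟨n, hn, h₁, h₂⟩ := Q.exists_between_of_separates_s5 hsep hx (Q.orient_symm ht) hxs
    rcases hm with hm | hm
    · exact hin m hm ⟨x, hx, n, hn, z, hz, h₁, Q.lt_trans_s5 h₂ (Q.lt_of_le_of_lt hsy hyz)⟩
    · exact hmin n (hypRel_of_orient hm hn) h₂ h₁
  exact (Q.orient_unique hxs (Q.orient_symm hx) ht hlt).1

theorem quotLT_trans (hr : Q.IsAdmissible r) (hLF : Q.LocallyFinite) {a b c : P}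
    (hab : Q.QuotLT r a b) (hbc : Q.QuotLT r b c) : Q.QuotLT r a c := by
  have hdisj : ∀ a' c', r a a' → r c c' → Q.disjointHyp a' c' := fun a' c' ha hc => by
    obtain ⟨m, -, x, hx, y, -, z, hz, hxy, hyz⟩ := hr.exists_separates hLF hab hbc ha hc
    exact Q.disjointHyp_of_lt hx hz (Q.lt_trans_s5 hxy hyz)
  refine ⟨fun hac => (hdisj c c hac (hr.equiv.refl c)).1 (Or.inl rfl), hdisj,
    fun a' c' ha hc hin => ?_⟩
  obtain ⟨m, hm, x, hx, y, hy, z, hz, hxy, hyz⟩ := hr.exists_separates hLF hab hbc ha hc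
  have hby := hypRel_of_orient hm hy
  have hax : a' = x := left_eq_of_between hLF hab ha hx hby hz hxy hyz
    fun n hn => hin n (Or.inl hn)
  have mem_star {u v : P} (h : u ∈ Q.orient v) : Q.star u ∈ Q.orient (Q.star v) :=
    Q.star_mem_orient_s5 (Q.orient_trans h (Or.inr (Q.star_star v).symm))
  have hcz : Q.star c' = Q.star z := left_eq_of_between hLF (hr.quotLT_star hbc)
    (hr.aer2 _ _ hc) (mem_star hz)
    (hypRel_of_orient (hr.hypRel_star hby) (Or.inr rfl)) (mem_star hx)
    (Q.star_lt hyz) (Q.star_lt hxy) fun n hn hs => hin n (Or.inr (hr.hypRel_star_iff.1 hn))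
      (Q.separates_symm (Q.separates_of_orient hs (Or.inr rfl) (Or.inr rfl)))
  have hcz' : c' = z := by rw [← Q.star_star c', hcz, Q.star_star]
  rw [hax, hcz']
  exact Q.lt_trans_s5 hxy hyz

theorem not_quotLT_of_mem_orient (hr : Q.IsAdmissible r) {a b : P} (hb : b ∈ Q.orient a) :
    ¬ Q.QuotLT r a b := fun h =>
  (h.2.1 a b (hr.equiv.refl a) (hr.equiv.refl b)).1 hb

theorem quotLE_congr (hr : Q.IsAdmissible r) {a b a' b' : P} (ha : r a a') (hb : r b b')
    (hab : Q.QuotLE r a b) : Q.QuotLE r a' b' :=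
  hab.imp (fun h => hr.equiv.trans (hr.equiv.symm ha) (hr.equiv.trans h hb))
    (hr.quotLT_congr ha hb)

theorem quotLE_trans (hr : Q.IsAdmissible r) (hLF : Q.LocallyFinite) {a b c : P}
    (hab : Q.QuotLE r a b) (hbc : Q.QuotLE r b c) : Q.QuotLE r a c := by
  rcases hab with h₁ | h₁
  · exact hr.quotLE_congr (hr.equiv.symm h₁) (hr.equiv.refl c) hbc
  rcases hbc with h₂ | h₂
  · exact Or.inr (hr.quotLT_congr (hr.equiv.refl a) h₂ h₁)
  · exact Or.inr (hr.quotLT_trans hLF h₁ h₂)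

theorem rel_of_quotLE_of_quotLE (hr : Q.IsAdmissible r) (hLF : Q.LocallyFinite) {a b : P}
    (hab : Q.QuotLE r a b) (hba : Q.QuotLE r b a) : r a b := by
  rcases hab with h₁ | h₁
  · exact h₁
  rcases hba with h₂ | h₂
  · exact hr.equiv.symm h₂
  · exact absurd (hr.quotLT_trans hLF h₁ h₂) (hr.not_quotLT_of_mem_orient (Or.inl rfl))

theorem not_quotLE_star (hr : Q.IsAdmissible r) (a : P) : ¬ Q.QuotLE r a (Q.star a) := by
  rintro (h | h)
  · exact hr.aer1 a h
  · exact hr.not_quotLT_of_mem_orient (Or.inr rfl) h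

/-- The pocset `P/∼`. -/
def quotient (hr : Q.IsAdmissible r) (hLF : Q.LocallyFinite) : Pocset (Quot r) where
  le := Quot.lift₂ (Q.QuotLE r)
    (fun a _ _ h => propext ⟨hr.quotLE_congr (hr.equiv.refl a) h,
      hr.quotLE_congr (hr.equiv.refl a) (hr.equiv.symm h)⟩)
    (fun _ _ b h => propext ⟨hr.quotLE_congr h (hr.equiv.refl b),
      hr.quotLE_congr (hr.equiv.symm h) (hr.equiv.refl b)⟩)
  star := Quot.map Q.star hr.aer2
  le_refl := by rintro ⟨a⟩; exact Or.inl (hr.equiv.refl a)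
  le_trans := by rintro ⟨a⟩ ⟨b⟩ ⟨c⟩; exact hr.quotLE_trans hLF
  le_antisymm := by
    rintro ⟨a⟩ ⟨b⟩ hab hba
    exact Quot.sound (hr.rel_of_quotLE_of_quotLE hLF hab hba)
  star_star := by rintro ⟨a⟩; exact congrArg (Quot.mk r) (Q.star_star a)
  star_antitone := by
    rintro ⟨a⟩ ⟨b⟩ hab
    exact hab.imp (fun h => hr.equiv.symm (hr.aer2 _ _ h)) hr.quotLT_star
  ne_star := by
    rintro ⟨a⟩ h
    exact hr.aer1 a ((hr.equiv.quot_mk_eq_iff _ _).1 h)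
  not_le_star := by rintro ⟨a⟩; exact hr.not_quotLE_star a
  not_star_le := by
    rintro ⟨a⟩ h
    refine hr.not_quotLE_star (Q.star a) ?_
    rw [Q.star_star]
    exact h

theorem simRel_mk (hr : Q.IsAdmissible r) : simRel (Quot.mk r) = r := by
  funext a b
  exact propext (hr.equiv.quot_mk_eq_iff a b)

theorem sameHyp_mk (hr : Q.IsAdmissible r) (hLF : Q.LocallyFinite) {h k : P} :
    (hr.quotient hLF).sameHyp (Quot.mk r k) (Quot.mk r h) ↔ Q.hypRel r h k :=
  or_congr (hr.equiv.quot_mk_eq_iff h k) (hr.equiv.quot_mk_eq_iff h (Q.star k))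

theorem exists_orient_mk (hr : Q.IsAdmissible r) (hLF : Q.LocallyFinite) {h : P} {x : Quot r}
    (hx : x ∈ (hr.quotient hLF).orient (Quot.mk r h)) : ∃ a ∈ Q.orient h, x = Quot.mk r a := by
  rcases hx with rfl | rfl
  · exact ⟨h, Or.inl rfl, rfl⟩
  · exact ⟨_, Or.inr rfl, rfl⟩

theorem transverse_mk (hr : Q.IsAdmissible r) (hLF : Q.LocallyFinite) {h k : P}
    (ht : Q.QuotTransverse r h k) :
    (hr.quotient hLF).transverse (Quot.mk r h) (Quot.mk r k) := by
  refine ⟨fun hs => ht.1 (hr.hypRel_symm ((hr.sameHyp_mk hLF).1 hs)), fun x hx y hy => ?_⟩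
  obtain ⟨a, ha, rfl⟩ := hr.exists_orient_mk hLF hx
  obtain ⟨b, hb, rfl⟩ := hr.exists_orient_mk hLF hy
  exact ht.2 a ha b hb

theorem quotTransverse_of_transverse (hr : Q.IsAdmissible r) {h k : P}
    (ht : Q.transverse h k) : Q.QuotTransverse r h k := by
  have e := hr.equiv
  have hrel : ∀ a ∈ Q.orient h, ∀ b ∈ Q.orient k, ¬ r a b := fun a ha b hb => by
    refine hr.aer3 a b ⟨fun hs => ht.1 ?_, fun x hx y hy => ?_⟩
    · exact Q.orient_trans (Q.orient_trans (Q.orient_symm hb) hs) ha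
    · exact ht.2 x (Q.orient_trans hx ha) y (Q.orient_trans hy hb)
  refine ⟨?_, fun a ha b hb => ⟨?_, ?_⟩⟩
  · rintro (h₁ | h₁)
    · exact hrel _ (Or.inl rfl) _ (Or.inl rfl) h₁
    · exact hrel _ (Or.inl rfl) _ (Or.inr rfl) h₁
  · rintro (h₁ | h₁)
    · exact hrel a ha b hb h₁
    · exact (Q.disjointHyp_of_orient (h₁.2.1 a b (e.refl a) (e.refl b)) ha hb).2 ht
  · rintro (h₁ | h₁)
    · exact hrel a ha b hb (e.symm h₁)
    · exact (Q.disjointHyp_of_orient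
        (Q.disjointHyp_symm (h₁.2.1 b a (e.refl b) (e.refl a))) ha hb).2 ht

theorem isAdmissibleMap_mk (hr : Q.IsAdmissible r) (hLF : Q.LocallyFinite) :
    IsAdmissibleMap Q (hr.quotient hLF) (Quot.mk r) where
  am1 _ := rfl
  am2 _ _ ht := hr.transverse_mk hLF (hr.quotTransverse_of_transverse ht)
  am3 h k hf hs hin := by
    refine Quot.sound (hr.aer4 h k (hr.hypRel_symm ((hr.sameHyp_mk hLF).1 hs)) ?_ ?_
      h (Or.inl rfl) k (Or.inl rfl) hf)
    · exact Q.not_sameHyp_of_lt (Or.inr rfl) (Or.inl rfl) hf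
    · exact fun m hm => hin m ((hr.sameHyp_mk hLF).2 hm)
  am4 := by
    rintro ⟨a⟩ ha
    exact absurd (Or.inl rfl) (ha a)

end IsAdmissible

end Pocset

/-- the quotient map `P → P/∼` by an admissible equivalence
relation is a resolution of pocsets (where `P/∼` carries the quotient pocset
structure). -/
theorem quotient_map_is_resolution {P : Type u} (Q : Pocset P)
    (hLF : Q.LocallyFinite) (r : P → P → Prop) (hr : Q.IsAdmissible r) :
    ∃ Qr : Pocset (Quot r),
      (∀ a b : P, Qr.le (Quot.mk r a) (Quot.mk r b) ↔ Q.QuotLE r a b) ∧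
      (∀ a : P, Qr.star (Quot.mk r a) = Quot.mk r (Q.star a)) ∧
      Pocset.IsResolution Q Qr (Quot.mk r) := by
  refine ⟨hr.quotient hLF, fun _ _ => Iff.rfl, fun _ => rfl, hr.isAdmissibleMap_mk hLF,
    ?_, ?_, ?_, ?_⟩
  · rwa [hr.simRel_mk]
  · rw [hr.simRel_mk]
    exact fun h k => hr.transverse_mk hLF
  · rw [hr.simRel_mk]
    rintro h k hf (hs | hs) -
    · exact hs.symm
    · exact absurd (hr.equiv.symm ((hr.equiv.quot_mk_eq_iff _ _).1 hs)) hf.1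
  · rw [hr.simRel_mk]
    exact fun _ _ h => h
end
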